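/- arXiv:1908.07838 — 3 statements merged into one kernel-verified Lean document; each statement's English description precedes it below -/
import Mathlib

section
/- Let m ≥ 2 and let Ω ⊂ ℝ^m be a bounded open connected set. Then there exist d = 5 smooth, globally bounded vector fields V_1,…,V_5 : ℝ^m → ℝ^m with the following property: for every N ∈ ℕ, every tuple of pairwise distinct points x_1,…,x_N ∈ Ω and every tuple of pairwise distinct points y_1,…,y_N ∈ Ω, there exist smooth controls u^1,…,u^5 : [0,1] → ℝ such that for each i = 1,…,N the solution X^{x_i} of the controlled ODE d/dt X_t = Σ_{j=1}^5 u^j_t V_j(X_t) with X_0 = x_i satisfies X^{x_i}_1 = y_i. -/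
open Set MeasureTheory

noncomputable section

open scoped ContDiff Topology

section Steering

variable {ι κ E : Type*} [Fintype ι] [NormedAddCommGroup E] [NormedSpace ℝ E]

/-- `Steers V p q` means that smooth controls supported in the unit time interval drive each point
`p i` to `q i` simultaneously along the vector fields `V`. -/
def Steers (V : ι → E → E) (p q : κ → E) : Prop :=
  ∃ u : ι → ℝ → ℝ, (∀ j, ContDiff ℝ ∞ (u j)) ∧ (∀ j, ∀ t ≤ 0, u j t = 0) ∧
    (∀ j, ∀ t ≥ 1, u j t = 0) ∧ ∀ i, ∃ X : ℝ → E,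
      (∀ t, HasDerivAt X (∑ j, u j t • V j (X t)) t) ∧
      (∀ t ≤ 0, X t = p i) ∧ ∀ t ≥ 1, X t = q i

theorem Steers.refl (V : ι → E → E) (p : κ → E) : Steers V p p :=
  ⟨fun _ _ => 0, fun _ => contDiff_const, fun _ _ _ => rfl, fun _ _ _ => rfl, fun i =>
    ⟨fun _ => p i, fun t => by simpa using hasDerivAt_const t (p i), fun _ _ => rfl,
      fun _ _ => rfl⟩⟩

theorem Steers.trans {V : ι → E → E} {p q r : κ → E} (hpq : Steers V p q) (hqr : Steers V q r) :
    Steers V p r := by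
  obtain ⟨u, hu, hu0, hu1, hX⟩ := hpq
  obtain ⟨v, hv, hv0, hv1, hY⟩ := hqr
  refine ⟨fun j t => 2 * u j (2 * t) + 2 * v j (2 * t - 1), fun j => ?_, fun j t ht => ?_,
    fun j t ht => ?_, fun i => ?_⟩
  · have h1 := (hu j).comp (contDiff_const.mul contDiff_id : ContDiff ℝ ∞ fun t : ℝ => 2 * t)
    have h2 := (hv j).comp ((contDiff_const.mul contDiff_id).sub contDiff_const :
      ContDiff ℝ ∞ fun t : ℝ => 2 * t - 1)
    exact (contDiff_const.mul h1).add (contDiff_const.mul h2)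
  · simp [hu0 j (2 * t) (by linarith), hv0 j (2 * t - 1) (by linarith)]
  · simp [hu1 j (2 * t) (by linarith), hv1 j (2 * t - 1) (by linarith)]
  obtain ⟨X, hXd, hX0, hX1⟩ := hX i
  obtain ⟨Y, hYd, hY0, hY1⟩ := hY i
  refine ⟨fun t => X (2 * t) + Y (2 * t - 1) - q i, fun t => ?_, fun t ht => ?_, fun t ht => ?_⟩
  · have h2 : HasDerivAt (fun t : ℝ => 2 * t) 2 t := by
      simpa using (hasDerivAt_id t).const_mul (2 : ℝ)
    have hd := (((hXd (2 * t)).scomp t h2).add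
      ((hYd (2 * t - 1)).scomp t (h2.sub_const 1))).sub_const (q i)
    refine hd.congr_deriv ?_
    simp only [Finset.smul_sum, smul_smul, ← Finset.sum_add_distrib]
    refine Finset.sum_congr rfl fun j _ => ?_
    rcases le_total t (1 / 2) with h | h
    · simp [hY0 (2 * t - 1) (by linarith), hv0 j (2 * t - 1) (by linarith)]
    · simp [hX1 (2 * t) (by linarith), hu1 j (2 * t) (by linarith)]
  · simp [hX0 (2 * t) (by linarith), hY0 (2 * t - 1) (by linarith)]
  · simp [hX1 (2 * t) (by linarith), hY1 (2 * t - 1) (by linarith)]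

theorem deriv_smoothTransition_of_nonpos {t : ℝ} (ht : t ≤ 0) :
    deriv Real.smoothTransition t = 0 :=
  IsLocalMin.deriv_eq_zero <| .of_forall fun s => by
    rw [Real.smoothTransition.zero_of_nonpos ht]
    exact Real.smoothTransition.nonneg s

theorem deriv_smoothTransition_of_one_le {t : ℝ} (ht : 1 ≤ t) :
    deriv Real.smoothTransition t = 0 :=
  IsLocalMax.deriv_eq_zero <| .of_forall fun s => by
    rw [Real.smoothTransition.one_of_one_le ht]
    exact Real.smoothTransition.le_one s

/-- Reparametrizing time smoothly, one can follow the integral curves of a multiple of `V j`. -/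
theorem steers_of_integralCurve [DecidableEq ι] (V : ι → E → E) (j : ι) (T : ℝ)
    (c : κ → ℝ → E) (hc : ∀ i, ∀ s ∈ Icc (0 : ℝ) 1, HasDerivAt (c i) (T • V j (c i s)) s) :
    Steers V (fun i => c i 0) (fun i => c i 1) := by
  refine ⟨fun k t => if k = j then T * deriv Real.smoothTransition t else 0, fun k => ?_,
    fun k t ht => ?_, fun k t ht => ?_, fun i => ⟨fun t => c i (Real.smoothTransition t),
    fun t => ?_, fun t ht => ?_, fun t ht => ?_⟩⟩
  · by_cases h : k = j
    · simp only [h, if_true]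
      have : ContDiff ℝ ∞ (deriv Real.smoothTransition) :=
        (contDiff_infty_iff_deriv.1 Real.smoothTransition.contDiff).2
      exact contDiff_const.mul this
    · simpa only [h, if_false] using contDiff_const
  · simp [deriv_smoothTransition_of_nonpos ht]
  · simp [deriv_smoothTransition_of_one_le ht]
  · have h1 : HasDerivAt Real.smoothTransition (deriv Real.smoothTransition t) t :=
      ((Real.smoothTransition.contDiff (n := 1)).differentiable (by simp) t).hasDerivAt
    refine ((hc i _ ⟨Real.smoothTransition.nonneg t,
      Real.smoothTransition.le_one t⟩).scomp t h1).congr_deriv ?_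
    simp [ite_smul, smul_smul, mul_comm]
  · simp [Real.smoothTransition.zero_of_nonpos ht]
  · simp [Real.smoothTransition.one_of_one_le ht]

end Steering

section Packing

variable {E : Type*} [NormedAddCommGroup E] [NormedSpace ℝ E]

/-- Countably many smooth vector fields supported in a fixed ball can be placed side by side along
a line to form a single bounded smooth vector field. -/
theorem exists_packed_vectorField {α : Type*} [Countable α] {e : E} (he : ‖e‖ = 1) {R C : ℝ}
    (hR : 0 < R) (hC : 0 ≤ C) (g : α → E → E) (hg : ∀ a, ContDiff ℝ ∞ (g a))
    (hgC : ∀ a x, ‖g a x‖ ≤ C) (hg0 : ∀ a, ∀ x ∉ Metric.ball (0 : E) R, g a x = 0) :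
    ∃ W : E → E, ContDiff ℝ ∞ W ∧ (∀ x, ‖W x‖ ≤ C) ∧
      ∀ a, ∃ c : ℝ, ∀ x ∈ Metric.ball (0 : E) R, W (x + c • e) = g a x := by
  obtain ⟨f, hf⟩ := exists_injective_nat α
  let s : α → E := fun a => (4 * R * f a) • e
  have hsep : ∀ a b, a ≠ b → 4 * R ≤ dist (s a) (s b) := by
    intro a b hab
    have h1 : (1 : ℝ) ≤ |(f a : ℝ) - f b| := by
      have : (f a : ℤ) - f b ≠ 0 := by
        have := hf.ne hab
        omega
      exact_mod_cast Int.one_le_abs this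
    have h2 : dist (s a) (s b) = 4 * R * |(f a : ℝ) - f b| := by
      rw [dist_eq_norm, ← sub_smul, norm_smul, he, mul_one, ← mul_sub, Real.norm_eq_abs, abs_mul,
        abs_of_pos (by positivity)]
    rw [h2]
    nlinarith
  let W : E → E := fun x => ∑' a, g a (x - s a)
  have hz : ∀ a x, R ≤ dist x (s a) → g a (x - s a) = 0 := fun a x hx =>
    hg0 a _ (by simpa [dist_eq_norm] using hx)
  have hW : ∀ a x, dist x (s a) < 3 * R → W x = g a (x - s a) := fun a x hx =>
    tsum_eq_single a fun b hb => hz b x (by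
      have := hsep a b hb.symm
      have := dist_triangle_left (s a) (s b) x
      linarith)
  have hloc : ∀ x, (∃ a, W =ᶠ[𝓝 x] fun y => g a (y - s a)) ∨ W =ᶠ[𝓝 x] fun _ => 0 := by
    intro x
    by_cases h : ∃ a, dist x (s a) < 2 * R
    · obtain ⟨a, ha⟩ := h
      refine .inl ⟨a, ?_⟩
      filter_upwards [Metric.ball_mem_nhds x hR] with y hy
      refine hW a y ?_
      have := dist_triangle y x (s a)
      have := Metric.mem_ball.1 hy
      linarith
    · push Not at h
      refine .inr ?_
      filter_upwards [Metric.ball_mem_nhds x hR] with y hy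
      have h0 : ∀ a, g a (y - s a) = 0 := fun a => hz a y (by
        have := h a
        have := dist_triangle_left x (s a) y
        have := Metric.mem_ball.1 hy
        linarith)
      simp [W, h0]
  refine ⟨W, contDiff_iff_contDiffAt.2 fun x => ?_, fun x => ?_, fun a => ⟨4 * R * f a, ?_⟩⟩
  · rcases hloc x with ⟨a, ha⟩ | h
    · exact ((hg a).comp (contDiff_id.sub contDiff_const)).contDiffAt.congr_of_eventuallyEq ha
    · exact contDiffAt_const.congr_of_eventuallyEq h
  · rcases hloc x with ⟨a, ha⟩ | h
    · rw [ha.eq_of_nhds]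
      exact hgC a _
    · rw [h.eq_of_nhds]
      simpa using hC
  · intro x hx
    have h1 : dist (x + s a) (s a) = ‖x‖ := by simp [dist_eq_norm]
    have h2 : ‖x‖ < R := by simpa using hx
    change W (x + s a) = _
    rw [hW a _ (by linarith), add_sub_cancel_right]

end Packing

section LocalMoves

variable {E : Type*} [NormedAddCommGroup E] [InnerProductSpace ℝ E]

/-- A countable family of bump fields supported in a ball `B`: near every point of an open subset
`U` of `B`, and for every `k`, some member of the family is equal to `v k` and vanishes off `U`. -/
theorem exists_countable_bump_fields [TopologicalSpace.SeparableSpace E] {ι : Type*} [Countable ι]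
    (v : ι → E) (hv : ∀ k, ‖v k‖ = 1) (ρ : ℝ) :
    ∃ (α : Type) (_ : Countable α) (g : α → E → E), (∀ a, ContDiff ℝ ∞ (g a)) ∧
      (∀ a x, ‖g a x‖ ≤ 1) ∧ (∀ a, ∀ x ∉ Metric.ball (0 : E) ρ, g a x = 0) ∧
      ∀ U : Set E, IsOpen U → U ⊆ Metric.ball 0 ρ → ∀ x ∈ U, ∃ r > 0, Metric.ball x r ⊆ U ∧
        ∀ k, ∃ a, (∀ y ∈ Metric.ball x r, g a y = v k) ∧ ∀ y ∉ U, g a y = 0 := by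
  obtain ⟨w, hw⟩ := exists_injective_nat ι
  let d : ℕ → E := TopologicalSpace.denseSeq E
  let B : (n l : ℕ) → ContDiffBump (d n) := fun n l =>
    ⟨1 / ((l : ℝ) + 1), 2 * (1 / ((l : ℝ) + 1)), by positivity, by
      have : (0 : ℝ) < 1 / ((l : ℝ) + 1) := by positivity
      linarith⟩
  let α := {a : ℕ × ℕ × range w // Metric.ball (d a.1) (B a.1 a.2.1).rOut ⊆ Metric.ball 0 ρ}
  let dir : range w → ι := fun k => k.2.choose
  have hdir : ∀ k, dir ⟨w k, k, rfl⟩ = k := fun k => hw (Exists.choose_spec (_ : ∃ y, w y = w k))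
  refine ⟨α, inferInstance, fun a x => B a.1.1 a.1.2.1 x • v (dir a.1.2.2), fun a => ?_,
    fun a x => ?_, fun a x hx => ?_, fun U hU hUρ x hx => ?_⟩
  · exact (B a.1.1 a.1.2.1).contDiff.smul contDiff_const
  · rw [norm_smul, hv, mul_one, Real.norm_eq_abs, abs_of_nonneg (B a.1.1 a.1.2.1).nonneg]
    exact (B a.1.1 a.1.2.1).le_one
  · have : x ∉ Metric.ball (d a.1.1) (B a.1.1 a.1.2.1).rOut := fun h => hx (a.2 h)
    simp [(B a.1.1 a.1.2.1).zero_of_le_dist (by simpa using this)]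
  · obtain ⟨ε, hε, hεU⟩ := Metric.isOpen_iff.1 hU x hx
    obtain ⟨l, hl⟩ := exists_nat_one_div_lt (show 0 < ε / 3 by positivity)
    set r : ℝ := 1 / ((l : ℝ) + 1) with hr
    have hr0 : 0 < r := by positivity
    obtain ⟨n, hn⟩ := (TopologicalSpace.denseRange_denseSeq E).exists_dist_lt x
      (show 0 < r / 2 by positivity)
    have hn' : dist x (d n) < r / 2 := hn
    have hBU : Metric.ball (d n) (B n l).rOut ⊆ U := fun y hy => hεU (by
      have h1 : dist y (d n) < 2 * r := hy
      have := dist_triangle_right y x (d n)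
      rw [Metric.mem_ball]
      linarith)
    have hxB : Metric.ball x (r / 2) ⊆ Metric.closedBall (d n) (B n l).rIn := fun y hy => by
      have h1 : dist y x < r / 2 := hy
      have := dist_triangle y x (d n)
      change dist y (d n) ≤ r
      linarith
    refine ⟨r / 2, by positivity, fun y hy => hεU (Metric.ball_subset_ball (by linarith) hy),
      fun k => ⟨⟨(n, l, ⟨w k, k, rfl⟩), hBU.trans hUρ⟩, fun y hy => ?_, fun y hy => ?_⟩⟩
    · simp [(B n l).one_of_mem_closedBall (hxB hy), hdir]
    · have : y ∉ Metric.ball (d n) (B n l).rOut := fun h => hy (hBU h)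
      simp [(B n l).zero_of_le_dist (by simpa using this)]

open Function in
/-- If the vector fields `V` can move the point `i` of any configuration in the ball along short
segments in the directions of an orthonormal basis, they can move it to any nearby position. -/
theorem steers_update_of_basis {ι κ ν : Type*} [Fintype ι] [Fintype ν] [DecidableEq κ]
    (b : OrthonormalBasis ν ℝ E) (V : ι → E → E) (p : κ → E) (i : κ) {x : E} {r : ℝ}
    (hr : 0 < r)
    (h : ∀ k (s : ℝ), ∀ z ∈ Metric.ball x r, z + s • b k ∈ Metric.ball x r →
      Steers V (update p i z) (update p i (z + s • b k))) :
    ∃ δ > 0, ∀ z ∈ Metric.ball x δ, ∀ w ∈ Metric.ball x δ,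
      Steers V (update p i z) (update p i w) := by
  classical
  have hn : (0 : ℝ) < 2 * Fintype.card ν + 1 := by positivity
  refine ⟨r / (2 * Fintype.card ν + 1), by positivity, fun z hz w hw => ?_⟩
  set δ := r / (2 * Fintype.card ν + 1) with hδ
  have hrδ : (2 * Fintype.card ν + 1) * δ = r := by rw [hδ]; field_simp
  have hδ0 : 0 < δ := by positivity
  have hzw : ‖w - z‖ ≤ 2 * δ := by
    rw [← dist_eq_norm]
    have := dist_triangle_right w z x
    rw [Metric.mem_ball] at hz hw
    linarith
  have hmem : ∀ S : Finset ν, z + ∑ k ∈ S, inner ℝ (b k) (w - z) • b k ∈ Metric.ball x r := by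
    intro S
    have h1 : ‖∑ k ∈ S, inner ℝ (b k) (w - z) • b k‖ ≤ Fintype.card ν * (2 * δ) := by
      calc ‖∑ k ∈ S, inner ℝ (b k) (w - z) • b k‖
          ≤ ∑ _k ∈ S, 2 * δ := norm_sum_le_of_le _ fun k _ => by
            rw [norm_smul, b.norm_eq_one, mul_one]
            exact (norm_inner_le_norm _ _).trans (by simpa [b.norm_eq_one] using hzw)
        _ ≤ Fintype.card ν * (2 * δ) := by
            rw [Finset.sum_const, nsmul_eq_mul]
            gcongr
            exact Finset.card_le_univ S
    have h2 := dist_triangle (z + ∑ k ∈ S, inner ℝ (b k) (w - z) • b k) z x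
    rw [dist_self_add_left] at h2
    rw [Metric.mem_ball] at hz ⊢
    linarith
  have key : ∀ S : Finset ν,
      Steers V (update p i z) (update p i (z + ∑ k ∈ S, inner ℝ (b k) (w - z) • b k)) := by
    intro S
    induction S using Finset.induction_on with
    | empty => simpa using Steers.refl V _
    | insert k S hk ih =>
      have e : z + ∑ l ∈ insert k S, inner ℝ (b l) (w - z) • b l =
          (z + ∑ l ∈ S, inner ℝ (b l) (w - z) • b l) + inner ℝ (b k) (w - z) • b k := by
        rw [Finset.sum_insert hk]; abel
      rw [e]
      exact ih.trans (h k _ _ (hmem S) (e ▸ hmem _))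
  have hfin := key Finset.univ
  rwa [b.sum_repr', add_sub_cancel] at hfin

end LocalMoves

section Configurations

theorem isPreconnected_ball_diff_finite {E : Type*} [NormedAddCommGroup E]
    [InnerProductSpace ℝ E] (hE : 1 < Module.rank ℝ E) (c : E) {r : ℝ} (hr : 0 < r) {F : Set E}
    (hF : F.Finite) : IsPreconnected (Metric.ball c r \ F) := by
  let φ := OpenPartialHomeomorph.univBall c r
  have hsrc : φ.source = univ := OpenPartialHomeomorph.univBall_source c r
  have hinj : Function.Injective φ := by
    rw [← injOn_univ, ← hsrc]
    exact φ.injOn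
  have hcont : Continuous φ := by
    rw [← continuousOn_univ, ← hsrc]
    exact φ.continuousOn
  have hrange : range φ = Metric.ball c r := by
    rw [← OpenPartialHomeomorph.univBall_target c hr, ← φ.image_source_eq_target, hsrc, image_univ]
  have hpre : (φ ⁻¹' F)ᶜ.Nonempty ∧ IsPreconnected (φ ⁻¹' F)ᶜ :=
    (hF.preimage hinj.injOn).countable.isConnected_compl_of_one_lt_rank hE
  have himg : φ '' (φ ⁻¹' F)ᶜ = Metric.ball c r \ F := by
    rw [← preimage_compl, image_preimage_eq_range_inter, hrange, sdiff_eq]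
  exact himg ▸ hpre.2.image φ hcont.continuousOn

open Function

variable {ι κ E : Type*} [Fintype ι] [Finite κ] [NormedAddCommGroup E] [NormedSpace ℝ E]

/-- If single points can be moved freely within `Ω` off the others, then the points of a
configuration can be moved one at a time to a disjoint configuration. -/
theorem steers_of_disjoint [DecidableEq κ] {V : ι → E → E} {Ω : Set E}
    (h : ∀ p : κ → E, (∀ j, p j ∈ Ω) → ∀ i, ∀ w ∈ Ω, (∀ j ≠ i, p j ≠ w) → (∀ j ≠ i, p j ≠ p i) →
      Steers V p (update p i w))
    {x z : κ → E} (hx : ∀ i, x i ∈ Ω) (hz : ∀ i, z i ∈ Ω) (hxi : Injective x) (hzi : Injective z)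
    (hxz : ∀ i j, x i ≠ z j) : Steers V x z := by
  have := Fintype.ofFinite κ
  have key : ∀ S : Finset κ, Steers V x (S.piecewise z x) := by
    intro S
    induction S using Finset.induction_on with
    | empty => simpa using Steers.refl V x
    | insert i S hi ih =>
      rw [Finset.piecewise_insert]
      refine ih.trans (h _ (fun j => ?_) i _ (hz i) (fun j hj => ?_) fun j hj => ?_)
      · by_cases hjS : j ∈ S <;> simp [hjS, hx, hz]
      · by_cases hjS : j ∈ S
        · simpa [hjS] using hzi.ne hj
        · simpa [hjS] using hxz j i
      · by_cases hjS : j ∈ S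
        · simpa [hjS, hi] using (hxz i j).symm
        · simpa [hjS, hi] using hxi.ne hj
  simpa using key Finset.univ

theorem steers_of_infinite [DecidableEq κ] {V : ι → E → E} {Ω : Set E} (hΩ : Ω.Infinite)
    (h : ∀ p : κ → E, (∀ j, p j ∈ Ω) → ∀ i, ∀ w ∈ Ω, (∀ j ≠ i, p j ≠ w) → (∀ j ≠ i, p j ≠ p i) →
      Steers V p (update p i w))
    {x y : κ → E} (hx : ∀ i, x i ∈ Ω) (hy : ∀ i, y i ∈ Ω) (hxi : Injective x)
    (hyi : Injective y) : Steers V x y := by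
  have hinf : (Ω \ (range x ∪ range y)).Infinite :=
    hΩ.sdiff ((finite_range x).union (finite_range y))
  obtain ⟨f, hf⟩ := exists_injective_nat κ
  let z : κ → E := fun i => hinf.natEmbedding _ (f i)
  have hz : ∀ i, z i ∈ Ω \ (range x ∪ range y) := fun i => (hinf.natEmbedding _ (f i)).2
  have hzi : Injective z :=
    Subtype.val_injective.comp ((hinf.natEmbedding _).injective.comp hf)
  refine (steers_of_disjoint h hx (fun i => (hz i).1) hxi hzi fun i j e => ?_).trans
    (steers_of_disjoint h (fun i => (hz i).1) hy hzi hyi fun i j e => ?_)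
  · exact (hz j).2 (.inl ⟨i, e⟩)
  · exact (hz i).2 (.inr ⟨j, e.symm⟩)

end Configurations

section Universality

open Function

variable {E : Type*} [NormedAddCommGroup E] [InnerProductSpace ℝ E]

/-- Conjugating the flow of a packed vector field by translations, one can follow the integral
curves of each of its constituents. -/
theorem steers_of_packed {ι κ : Type*} [Fintype ι] [DecidableEq ι] {V : ι → E → E} {j₀ j₁ : ι}
    {e : E} (he : ∀ x, V j₀ x = e) {ρ c : ℝ} {g : E → E}
    (hg : ∀ x ∈ Metric.ball (0 : E) ρ, V j₁ (x + c • e) = g x) (T : ℝ) (γ : κ → ℝ → E)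
    (hγρ : ∀ i, ∀ s ∈ Icc (0 : ℝ) 1, γ i s ∈ Metric.ball 0 ρ)
    (hγ : ∀ i, ∀ s ∈ Icc (0 : ℝ) 1, HasDerivAt (γ i) (T • g (γ i s)) s) :
    Steers V (fun i => γ i 0) (fun i => γ i 1) := by
  have shift : ∀ (p : κ → E) (a : ℝ), Steers V p (fun i => p i + a • e) := by
    intro p a
    have := steers_of_integralCurve V j₀ a (fun i s => p i + s • a • e) fun i s _ => by
      simpa [he] using ((hasDerivAt_id s).smul_const (a • e)).const_add (p i)
    simpa using this
  have h1 := shift (fun i => γ i 0) c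
  have h2 := steers_of_integralCurve V j₁ T (fun i s => γ i s + c • e) fun i s hs => by
    rw [hg _ (hγρ i s hs)]
    exact (hγ i s hs).add_const _
  have h3 := shift (fun i => γ i 1 + c • e) (-c)
  simp only [neg_smul, add_neg_cancel_right] at h3
  exact (h1.trans h2).trans h3

/-- On a ball of a Euclidean space of dimension at least two, two bounded smooth vector fields
suffice to interpolate between arbitrary finite configurations. -/
theorem exists_pair_steers [FiniteDimensional ℝ E] (hE : 1 < Module.rank ℝ E) {ρ : ℝ}
    (hρ : 0 < ρ) : ∃ (e : E) (W : E → E), ContDiff ℝ ∞ W ∧ (∀ x, ‖W x‖ ≤ 1) ∧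
      ∀ {ι κ : Type} [Fintype ι] [Finite κ] (V : ι → E → E) (j₀ j₁ : ι), (∀ x, V j₀ x = e) →
        (∀ x, V j₁ x = W x) → ∀ x y : κ → E, (∀ i, x i ∈ Metric.ball 0 ρ) →
        (∀ i, y i ∈ Metric.ball 0 ρ) → Injective x → Injective y → Steers V x y := by
  classical
  have : Nontrivial E := rank_pos_iff_nontrivial.1 (zero_lt_one.trans hE)
  let b := stdOrthonormalBasis ℝ E
  obtain ⟨e, he⟩ := exists_norm_eq E zero_le_one
  obtain ⟨α, _, g, hg, hg1, hg0, hgU⟩ := exists_countable_bump_fields b b.norm_eq_one ρ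
  obtain ⟨W, hW, hW1, hWg⟩ := exists_packed_vectorField he hρ zero_le_one g hg hg1 hg0
  refine ⟨e, W, hW, hW1, ?_⟩
  intro ι κ _ _ V j₀ j₁ hV₀ hV₁ x y hx hy hxi hyi
  have hinf : (Metric.ball (0 : E) ρ).Infinite :=
    infinite_of_mem_nhds 0 (Metric.ball_mem_nhds 0 hρ)
  refine steers_of_infinite hinf (fun p hp i w hw hpw hpi => ?_) hx hy hxi hyi
  let F : Set E := p '' {i}ᶜ
  have hF : F.Finite := toFinite _
  have hpF : ∀ j ≠ i, p j ∈ F := fun j hj => ⟨j, hj, rfl⟩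
  have local_move : ∀ z ∈ Metric.ball 0 ρ \ F, ∃ δ > 0, ∀ z₁ ∈ Metric.ball z δ,
      ∀ z₂ ∈ Metric.ball z δ, Steers V (update p i z₁) (update p i z₂) := by
    intro z hz
    obtain ⟨r, hr, hrU, hk⟩ :=
      hgU _ (Metric.isOpen_ball.sdiff hF.isClosed) sdiff_subset z hz
    refine steers_update_of_basis b V p i hr fun k s z₁ hz₁ hz₂ => ?_
    obtain ⟨a, hak, ha0⟩ := hk k
    obtain ⟨c, hc⟩ := hWg a
    have hseg : ∀ t ∈ Icc (0 : ℝ) 1, z₁ + t • s • b k ∈ Metric.ball z r := fun t ht =>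
      (convex_ball z r).add_smul_mem hz₁ hz₂ ht
    have hfixed : ∀ j ≠ i, g a (p j) = 0 := fun j hj => ha0 _ fun h => h.2 (hpF j hj)
    have hmove := steers_of_packed (V := V) (j₀ := j₀) (j₁ := j₁) hV₀
      (fun y hy => (hV₁ _).trans (hc y hy)) s (fun j t => update p i (z₁ + t • s • b k) j)
      (fun j t ht => ?_) (fun j t ht => ?_)
    · simpa using hmove
    · rcases eq_or_ne j i with rfl | hj
      · simpa using (hrU (hseg t ht)).1
      · simpa [hj] using hp j
    · rcases eq_or_ne j i with rfl | hj
      · simpa [hak _ (hseg t ht)] using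
          ((hasDerivAt_id t).smul_const (s • b k)).const_add z₁
      · simpa [hj, hfixed j hj] using hasDerivAt_const t (p j)
  have hiF : p i ∈ Metric.ball 0 ρ \ F :=
    ⟨hp i, fun ⟨j, hj, e⟩ => hpi j hj e⟩
  have hwF : w ∈ Metric.ball 0 ρ \ F := ⟨hw, fun ⟨j, hj, e⟩ => hpw j hj e⟩
  have := (isPreconnected_ball_diff_finite hE 0 hρ hF).induction₂'
    (fun z₁ z₂ => Steers V (update p i z₁) (update p i z₂)) (fun z hz => by
      obtain ⟨δ, hδ, h⟩ := local_move z hz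
      filter_upwards [mem_nhdsWithin_of_mem_nhds (Metric.ball_mem_nhds z hδ)] with z' hz'
      exact ⟨h _ (Metric.mem_ball_self hδ) _ hz', h _ hz' _ (Metric.mem_ball_self hδ)⟩)
    (fun _ _ _ _ _ _ h h' => h.trans h') hiF hwF
  simpa using this

end Universality

/-- For `m ≥ 2` and a bounded open connected `Ω ⊂ ℝ^m`, there exist `d = 5`
smooth, globally bounded vector fields `V_1,…,V_5` on `ℝ^m` such that for every `N`, every
tuple of pairwise distinct inputs `x_1,…,x_N ∈ Ω` and pairwise distinct targets
`y_1,…,y_N ∈ Ω`, there exist smooth controls `u^1,…,u^5 : [0,1] → ℝ` such that for each `i`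
the solution of `d/dt X_t = ∑_j u^j_t V_j(X_t)`, `X_0 = x_i`, satisfies `X_1 = y_i`. -/
theorem universal_interpolation_exists
    (m : ℕ) (hm : 2 ≤ m)
    (Ω : Set (EuclideanSpace ℝ (Fin m)))
    (hΩbdd : Bornology.IsBounded Ω) (hΩopen : IsOpen Ω) (hΩconn : IsConnected Ω) :
    ∃ V : Fin 5 → (EuclideanSpace ℝ (Fin m) → EuclideanSpace ℝ (Fin m)),
      (∀ j, ContDiff ℝ (⊤ : ℕ∞) (V j)) ∧
      (∀ j, ∃ C : ℝ, ∀ x, ‖V j x‖ ≤ C) ∧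
      ∀ (N : ℕ) (x y : Fin N → EuclideanSpace ℝ (Fin m)),
        (∀ i, x i ∈ Ω) → (∀ i, y i ∈ Ω) →
        Function.Injective x → Function.Injective y →
        ∃ u : Fin 5 → ℝ → ℝ,
          (∀ j, ContDiff ℝ (⊤ : ℕ∞) (u j)) ∧
          ∀ i, ∃ X : ℝ → EuclideanSpace ℝ (Fin m),
            X 0 = x i ∧
            (∀ t ∈ Set.Icc (0:ℝ) 1, HasDerivAt X (∑ j, u j t • V j (X t)) t) ∧
            X 1 = y i := by
  have hrank : 1 < Module.rank ℝ (EuclideanSpace ℝ (Fin m)) := by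
    rw [← Module.finrank_eq_rank, finrank_euclideanSpace_fin]
    exact_mod_cast hm
  obtain ⟨ρ, hρ, hΩρ⟩ := hΩbdd.subset_ball_lt 0 0
  obtain ⟨e, W, hW, hW1, hsteer⟩ := exists_pair_steers hrank hρ
  refine ⟨fun j => if j = 0 then fun _ => e else W, fun j => ?_, fun j => ?_,
    fun N x y hx hy hxi hyi => ?_⟩
  · dsimp only
    split_ifs
    · exact contDiff_const
    · exact hW
  · dsimp only
    split_ifs
    · exact ⟨‖e‖, fun _ => le_rfl⟩
    · exact ⟨1, hW1⟩
  · obtain ⟨u, hu, -, -, hX⟩ := hsteer (fun j : Fin 5 => if j = 0 then fun _ => e else W) 0 1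
      (fun _ => rfl) (fun _ => rfl) x y (fun i => hΩρ (hx i)) (fun i => hΩρ (hy i)) hxi hyi
    refine ⟨u, hu, fun i => ?_⟩
    obtain ⟨X, hXd, hX0, hX1⟩ := hX i
    exact ⟨X, hX0 0 le_rfl, fun t _ => hXd t, hX1 1 le_rfl⟩
end
end

section
/- (Chow–Rashevskii) Let Ω ⊆ ℝ^n be an open connected set and let U_1,…,U_d : ℝ^n → ℝ^n be smooth bounded vector fields satisfying the Hörmander condition Lie(U_1,…,U_d)(x) = ℝ^n at every point x ∈ Ω. Then for every pair (x,y) ∈ Ω × Ω there exist smooth controls u^1,…,u^d : [0,1] → ℝ such that the solution X of d/dt X_t = Σ_{i=1}^d u^i_t U_i(X_t) with X_0 = x satisfies X_1 = y. -/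
open Set MeasureTheory

noncomputable section

/-- The Lie bracket `[U,V](x) = DV(x)·U(x) − DU(x)·V(x)` of two vector fields. -/
def lieBracketVF {F : Type*} [NormedAddCommGroup F] [NormedSpace ℝ F]
    (U V : F → F) : F → F :=
  fun x => fderiv ℝ V x (U x) - fderiv ℝ U x (V x)

/-- `lieGen S` is the smallest ℝ-linear subspace of vector fields containing `S`
and closed under the Lie bracket, i.e. the generated Lie algebra of vector fields. -/
def lieGen {F : Type*} [NormedAddCommGroup F] [NormedSpace ℝ F]
    (S : Set (F → F)) : Set (F → F) :=
  ⋂₀ {T : Set (F → F) | S ⊆ T ∧ (0 : F → F) ∈ T ∧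
      (∀ f g, f ∈ T → g ∈ T → f + g ∈ T) ∧
      (∀ (c : ℝ) f, f ∈ T → c • f ∈ T) ∧
      (∀ f g, f ∈ T → g ∈ T → lieBracketVF f g ∈ T)}

open Filter Topology

section Superposition

variable {K : Type*} [TopologicalSpace K] [CompactSpace K]

/-- Pointwise application of a continuous family of linear maps to a continuous family of
vectors, as a bounded bilinear map. -/
def ContinuousMap.pointwiseApplyL {E F : Type*} [NormedAddCommGroup E] [NormedSpace ℝ E]
    [NormedAddCommGroup F] [NormedSpace ℝ F] :
    C(K, E →L[ℝ] F) →L[ℝ] C(K, E) →L[ℝ] C(K, F) :=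
  LinearMap.mkContinuous₂
    (LinearMap.mk₂ ℝ (fun (A : C(K, E →L[ℝ] F)) (h : C(K, E)) =>
        (⟨fun k => A k (h k), by fun_prop⟩ : C(K, F)))
      (fun _ _ _ => by ext; simp) (fun _ _ _ => by ext; simp)
      (fun _ _ _ => by ext; simp) (fun _ _ _ => by ext; simp)) 1
    (fun A h => by
      rw [one_mul, ContinuousMap.norm_le _ (by positivity)]
      exact fun k => ((A k).le_opNorm (h k)).trans
        (mul_le_mul (A.norm_coe_le_norm k) (h.norm_coe_le_norm k) (norm_nonneg _) (norm_nonneg A)))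

@[simp] lemma ContinuousMap.pointwiseApplyL_apply {E F : Type*} [NormedAddCommGroup E]
    [NormedSpace ℝ E] [NormedAddCommGroup F] [NormedSpace ℝ F]
    (A : C(K, E →L[ℝ] F)) (h : C(K, E)) (k : K) :
    ContinuousMap.pointwiseApplyL A h k = A k (h k) := rfl

lemma hasFDerivAt_continuousMap_comp {E F : Type*} [NormedAddCommGroup E] [NormedSpace ℝ E]
    [NormedAddCommGroup F] [NormedSpace ℝ F] (f : C(E, F)) (f' : C(E, E →L[ℝ] F))
    (hf : ∀ x, HasFDerivAt f (f' x) x) (X : C(K, E)) :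
    HasFDerivAt (fun Y : C(K, E) => f.comp Y) (ContinuousMap.pointwiseApplyL (f'.comp X)) X := by
  rw [hasFDerivAt_iff_isLittleO_nhds_zero, Asymptotics.isLittleO_iff]
  intro ε hε
  have huc := (isCompact_range X.continuous).uniformContinuousAt_of_continuousAt (f' : E → E →L[ℝ] F)
    (fun x _ => f'.continuous.continuousAt) (Metric.dist_mem_uniformity hε)
  obtain ⟨δ, hδ, H⟩ := Metric.mem_uniformity_dist.1 huc
  filter_upwards [Metric.ball_mem_nhds (0 : C(K, E)) hδ] with h hh
  rw [ContinuousMap.norm_le _ (by positivity)]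
  intro k
  have hk : ‖h k‖ < δ := (h.norm_coe_le_norm k).trans_lt (by simpa using hh)
  have key := (convex_ball (X k) δ).norm_image_sub_le_of_norm_hasFDerivWithin_le' (f := f)
    (f' := f') (φ := f' (X k)) (C := ε) (x := X k) (y := X k + h k)
    (fun x _ => (hf x).hasFDerivWithinAt)
    (fun x hx => by
      have h1 : dist (X k) x < δ := by rw [dist_comm]; exact hx
      have h2 := H h1 (mem_range_self k)
      rw [← dist_eq_norm, dist_comm]
      exact h2.le) (Metric.mem_ball_self hδ) (by simpa using hk)
  simp only [add_sub_cancel_left] at key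
  calc _ = ‖f (X k + h k) - f (X k) - f' (X k) (h k)‖ := by simp
    _ ≤ ε * ‖h k‖ := key
    _ ≤ ε * ‖h‖ := by gcongr; exact h.norm_coe_le_norm k

lemma contDiff_continuousMap_comp.{u} {E : Type u} [NormedAddCommGroup E] [NormedSpace ℝ E] (n : ℕ) :
    ∀ {F : Type u} [NormedAddCommGroup F] [NormedSpace ℝ F] (f : C(E, F)),
      ContDiff ℝ n f → ContDiff ℝ n (fun Y : C(K, E) => f.comp Y) := by
  induction n with
  | zero =>
    intro F _ _ f _
    exact contDiff_zero.2 f.continuous_postcomp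
  | succ n ih =>
    intro F _ _ f hf
    push_cast at hf ⊢
    have hf' := (contDiff_succ_iff_fderiv.1 hf).2.2
    let f' : C(E, E →L[ℝ] F) := ⟨fderiv ℝ f, hf'.continuous⟩
    refine contDiff_succ_iff_hasFDerivAt.2
      ⟨fun X => ContinuousMap.pointwiseApplyL (f'.comp X), ?_, ?_⟩
    · exact ContinuousMap.pointwiseApplyL.contDiff.comp (ih f' hf')
    · exact hasFDerivAt_continuousMap_comp f f'
        fun x => (hf.differentiable (by simp) x).hasFDerivAt

end Superposition

section Flow

variable {E : Type*} [NormedAddCommGroup E] [NormedSpace ℝ E]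

/-- The antiderivative vanishing at `0`, as an operator on continuous paths. -/
def pathIntegralL : C(Icc (0 : ℝ) 1, E) →L[ℝ] C(Icc (0 : ℝ) 1, E) :=
  LinearMap.mkContinuous
    { toFun := fun X => ⟨fun s => ∫ r in (0 : ℝ)..s, X (projIcc 0 1 zero_le_one r),
        (intervalIntegral.continuous_primitive
          (fun a b => (X.continuous.comp continuous_projIcc).intervalIntegrable a b) 0).comp
          continuous_subtype_val⟩
      map_add' := fun X Y => by
        ext s
        exact intervalIntegral.integral_add
          ((X.continuous.comp continuous_projIcc).intervalIntegrable _ _)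
          ((Y.continuous.comp continuous_projIcc).intervalIntegrable _ _)
      map_smul' := fun c X => by
        ext s
        exact intervalIntegral.integral_smul c _ } 1
    (fun X => by
      rw [one_mul, ContinuousMap.norm_le _ (norm_nonneg X)]
      intro s
      refine (intervalIntegral.norm_integral_le_of_norm_le_const
        (fun r _ => X.norm_coe_le_norm (projIcc 0 1 zero_le_one r))).trans ?_
      rw [sub_zero, abs_of_nonneg s.2.1]
      exact mul_le_of_le_one_right (norm_nonneg X) s.2.2)

lemma pathIntegralL_apply (X : C(Icc (0 : ℝ) 1, E)) (s : Icc (0 : ℝ) 1) :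
    pathIntegralL X s = ∫ r in (0 : ℝ)..s, X (projIcc 0 1 zero_le_one r) := rfl

variable [CompleteSpace E]

lemma pathIntegralL_const_one (v : E) :
    pathIntegralL (ContinuousMap.const _ v) ⟨1, right_mem_Icc.2 zero_le_one⟩ = v := by
  simp [pathIntegralL_apply]

lemma exists_integralCurve_of_fixedPoint (U : C(E, E)) (t : ℝ) (x : E)
    (Y : C(Icc (0 : ℝ) 1, E))
    (hY : Y - t • pathIntegralL (U.comp Y) = ContinuousMap.const _ x) :
    ∃ X : ℝ → E, X 0 = x ∧
      X 1 = x + t • pathIntegralL (U.comp Y) ⟨1, right_mem_Icc.2 zero_le_one⟩ ∧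
      ∀ s ∈ Icc (0 : ℝ) 1, HasDerivAt X (t • U (X s)) s := by
  refine ⟨fun s => x + t • ∫ r in (0 : ℝ)..s, U (Y (projIcc 0 1 zero_le_one r)), by simp,
    rfl, fun s hs => ?_⟩
  have hc : Continuous fun r : ℝ => U (Y (projIcc 0 1 zero_le_one r)) :=
    U.continuous.comp (Y.continuous.comp continuous_projIcc)
  have hYs : Y ⟨s, hs⟩ = x + t • ∫ r in (0 : ℝ)..s, U (Y (projIcc 0 1 zero_le_one r)) := by
    have := DFunLike.congr_fun hY ⟨s, hs⟩
    exact sub_eq_iff_eq_add.1 this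
  have := ((hc.integral_hasStrictDerivAt 0 s).hasDerivAt.const_smul t).const_add x
  rw [projIcc_of_mem _ hs, hYs] at this
  exact this

/-- A `C²` vector field has near `x₀` a `C²` flow for small times, whose derivative at time `0` is
the expected one. -/
lemma exists_contDiffAt_flow (U : E → E) (hU : ContDiff ℝ 2 U) (x₀ : E) :
    ∃ φ : ℝ × E → E, ContDiffAt ℝ 2 φ (0, x₀) ∧ φ (0, x₀) = x₀ ∧
      HasFDerivAt φ ((ContinuousLinearMap.fst ℝ ℝ E).smulRight (U x₀) +
        ContinuousLinearMap.snd ℝ ℝ E) (0, x₀) ∧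
      ∀ᶠ p in 𝓝 ((0 : ℝ), x₀), ∃ X : ℝ → E, X 0 = p.2 ∧ X 1 = φ p ∧
        ∀ s ∈ Icc (0 : ℝ) 1, HasDerivAt X (p.1 • U (X s)) s := by
  let Uc : C(E, E) := ⟨U, hU.continuous⟩
  let N : C(Icc (0 : ℝ) 1, E) → C(Icc (0 : ℝ) 1, E) := fun Y => pathIntegralL (Uc.comp Y)
  have hN : ContDiff ℝ 2 N :=
    pathIntegralL.contDiff.comp (contDiff_continuousMap_comp 2 Uc hU)
  let H : ℝ × C(Icc (0 : ℝ) 1, E) → ℝ × C(Icc (0 : ℝ) 1, E) := fun z => (z.1, z.2 - z.1 • N z.2)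
  have hH : ContDiff ℝ 2 H :=
    contDiff_fst.prodMk (contDiff_snd.sub (contDiff_fst.smul (hN.comp contDiff_snd)))
  let cst : E →L[ℝ] C(Icc (0 : ℝ) 1, E) :=
    { toFun := ContinuousMap.const _
      map_add' := fun _ _ => rfl
      map_smul' := fun _ _ => rfl
      cont := ContinuousMap.continuous_const' }
  let X₀ := cst x₀
  let L := (ContinuousLinearMap.fst ℝ ℝ C(Icc (0 : ℝ) 1, E))
  let S := (ContinuousLinearMap.snd ℝ ℝ C(Icc (0 : ℝ) 1, E))
  let A : (ℝ × C(Icc (0 : ℝ) 1, E)) ≃L[ℝ] (ℝ × C(Icc (0 : ℝ) 1, E)) :=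
    ContinuousLinearEquiv.equivOfInverse (L.prod (S - L.smulRight (N X₀)))
      (L.prod (S + L.smulRight (N X₀))) (fun z => by simp [L, S]) (fun z => by simp [L, S])
  have hA : HasFDerivAt H (A : (ℝ × C(Icc (0 : ℝ) 1, E)) →L[ℝ] (ℝ × C(Icc (0 : ℝ) 1, E)))
      (0, X₀) := by
    have h1 : HasFDerivAt (fun z : ℝ × C(Icc (0 : ℝ) 1, E) => N z.2)
        (fderiv ℝ (fun z : ℝ × C(Icc (0 : ℝ) 1, E) => N z.2) (0, X₀)) (0, X₀) :=
      ((hN.comp contDiff_snd).differentiable (by simp) _).hasFDerivAt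
    have h2 := L.hasFDerivAt.prodMk ((S.hasFDerivAt (x := (0, X₀))).sub
      ((L.hasFDerivAt (x := (0, X₀))).smul h1))
    refine h2.congr_fderiv ?_
    ext z <;> simp [A, L, S]
  have hst := hH.contDiffAt.hasStrictFDerivAt' hA (by simp)
  have hH0 : H (0, X₀) = (0, X₀) := by simp [H]
  let Θ := hst.localInverse H A (0, X₀)
  have hΘ : ContDiffAt ℝ 2 Θ (0, X₀) := by
    have := hH.contDiffAt.to_localInverse hA (by simp)
    rwa [hH0] at this
  have hΘ0 : Θ (0, X₀) = (0, X₀) := by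
    have := hst.localInverse_apply_image
    rwa [hH0] at this
  have hright : ∀ᶠ z in 𝓝 ((0 : ℝ), X₀), H (Θ z) = z := by
    have := hst.eventually_right_inverse
    rwa [hH0] at this
  let ι : ℝ × E →L[ℝ] ℝ × C(Icc (0 : ℝ) 1, E) :=
    (ContinuousLinearMap.id ℝ ℝ).prodMap cst
  let ev : C(Icc (0 : ℝ) 1, E) →L[ℝ] E :=
    ContinuousMap.evalCLM ℝ ⟨1, right_mem_Icc.2 zero_le_one⟩
  let g : ℝ × E → E := fun p => ev (N (Θ (ι p)).2)
  have hg : ContDiffAt ℝ 2 g (0, x₀) := by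
    refine ev.contDiff.contDiffAt.comp _ (hN.contDiffAt.comp _ ?_)
    exact contDiff_snd.contDiffAt.comp _ (ContDiffAt.comp (0, x₀) hΘ ι.contDiff.contDiffAt)
  have hg0 : g (0, x₀) = U x₀ := by
    have : ι (0, x₀) = (0, X₀) := rfl
    simp only [g, this, hΘ0]
    exact pathIntegralL_const_one (U x₀)
  refine ⟨fun p => p.2 + p.1 • g p, contDiffAt_snd.add (contDiffAt_fst.smul hg), by simp, ?_, ?_⟩
  · have h := ((ContinuousLinearMap.snd ℝ ℝ E).hasFDerivAt (x := (0, x₀))).add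
      (((ContinuousLinearMap.fst ℝ ℝ E).hasFDerivAt (x := (0, x₀))).smul
        (hg.differentiableAt (by simp)).hasFDerivAt)
    refine h.congr_fderiv ?_
    ext z <;> simp [hg0]
  · have hι : Tendsto ι (𝓝 (0, x₀)) (𝓝 (0, X₀)) := ι.continuous.tendsto' _ _ rfl
    filter_upwards [hι.eventually hright] with p hp
    have h1 : (Θ (ι p)).1 = p.1 := congrArg Prod.fst hp
    have h2 : (Θ (ι p)).2 - (Θ (ι p)).1 • N (Θ (ι p)).2 = cst p.2 := congrArg Prod.snd hp
    rw [h1] at h2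
    exact exists_integralCurve_of_fixedPoint Uc p.1 p.2 _ h2

end Flow

section Reach

variable {E : Type*} [NormedAddCommGroup E] [NormedSpace ℝ E] {d : ℕ} {U : Fin d → E → E}

/-- `y` can be reached from `x` along a solution of the controlled equation whose smooth controls
vanish outside `(0, 1)`. -/
def Reach (U : Fin d → E → E) (x y : E) : Prop :=
  ∃ (u : Fin d → ℝ → ℝ) (X : ℝ → E), (∀ i, ContDiff ℝ (⊤ : ℕ∞) (u i)) ∧
    (∀ i, ∀ t ≤ 0, u i t = 0) ∧ (∀ i, ∀ t, 1 ≤ t → u i t = 0) ∧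
    (∀ t ≤ 0, X t = x) ∧ (∀ t, 1 ≤ t → X t = y) ∧
    ∀ t, HasDerivAt X (∑ i, u i t • U i (X t)) t

lemma Reach.refl (x : E) : Reach U x x :=
  ⟨fun _ _ => 0, fun _ => x, fun _ => contDiff_const, by simp, by simp, by simp, by simp,
    fun t => by simpa using hasDerivAt_const t x⟩

lemma Reach.symm {x y : E} (h : Reach U x y) : Reach U y x := by
  obtain ⟨u, X, hu, hu0, hu1, hX0, hX1, hX⟩ := h
  refine ⟨fun i t => -u i (1 - t), fun t => X (1 - t), fun i => ?_, fun i t ht => ?_,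
    fun i t ht => ?_, fun t ht => hX1 _ (by linarith), fun t ht => hX0 _ (by linarith),
    fun t => ?_⟩
  · exact ((hu i).comp (contDiff_const.sub contDiff_id)).neg
  · simp [hu1 i (1 - t) (by linarith)]
  · simp [hu0 i (1 - t) (by linarith)]
  · have := (hX (1 - t)).scomp t ((hasDerivAt_id t).const_sub 1)
    simpa [Function.comp_def] using this

lemma Reach.trans {x y z : E} (h : Reach U x y) (h' : Reach U y z) : Reach U x z := by
  obtain ⟨u, X, hu, hu0, hu1, hX0, hX1, hX⟩ := h
  obtain ⟨v, Y, hv, hv0, hv1, hY0, hY1, hY⟩ := h'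
  refine ⟨fun i t => 2 * u i (2 * t) + 2 * v i (2 * t - 1),
    fun t => X (2 * t) + Y (2 * t - 1) - y, fun i => ?_, fun i t ht => ?_, fun i t ht => ?_,
    fun t ht => ?_, fun t ht => ?_, fun t => ?_⟩
  · have h1 : ContDiff ℝ (⊤ : ℕ∞) fun t : ℝ => 2 * t := contDiff_const.mul contDiff_id
    exact (contDiff_const.mul ((hu i).comp h1)).add
      (contDiff_const.mul ((hv i).comp (h1.sub contDiff_const)))
  · simp [hu0 i (2 * t) (by linarith), hv0 i (2 * t - 1) (by linarith)]
  · simp [hu1 i (2 * t) (by linarith), hv1 i (2 * t - 1) (by linarith)]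
  · simp [hX0 (2 * t) (by linarith), hY0 (2 * t - 1) (by linarith)]
  · simp [hX1 (2 * t) (by linarith), hY1 (2 * t - 1) (by linarith)]
  · have h2 : HasDerivAt (fun t : ℝ => 2 * t) 2 t := by simpa using (hasDerivAt_id t).const_mul 2
    have h := (((hX (2 * t)).scomp t h2).add
      ((hY (2 * t - 1)).scomp t (h2.sub_const 1))).sub_const y
    refine h.congr_deriv ?_
    rcases le_total t (1 / 2) with ht | ht
    · have e1 : Y (2 * t - 1) = y := hY0 _ (by linarith)
      have e2 : ∀ i, v i (2 * t - 1) = 0 := fun i => hv0 i _ (by linarith)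
      simp [e1, e2, Finset.smul_sum, mul_smul]
    · have e1 : X (2 * t) = y := hX1 _ (by linarith)
      have e2 : ∀ i, u i (2 * t) = 0 := fun i => hu1 i _ (by linarith)
      simp [e1, e2, Finset.smul_sum, mul_smul]

lemma Reach.of_integralCurve (j : Fin d) (a : ℝ) (X : ℝ → E)
    (hX : ∀ s ∈ Icc (0 : ℝ) 1, HasDerivAt X (a • U j (X s)) s) : Reach U (X 0) (X 1) := by
  have hθ : ContDiff ℝ (⊤ : ℕ∞) Real.smoothTransition := Real.smoothTransition.contDiff
  have hmin : ∀ t ≤ 0, deriv Real.smoothTransition t = 0 := fun t ht =>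
    IsLocalMin.deriv_eq_zero (Eventually.of_forall fun s => by
      rw [Real.smoothTransition.zero_of_nonpos ht]; exact Real.smoothTransition.nonneg s)
  have hmax : ∀ t, 1 ≤ t → deriv Real.smoothTransition t = 0 := fun t ht =>
    IsLocalMax.deriv_eq_zero (Eventually.of_forall fun s => by
      rw [Real.smoothTransition.one_of_one_le ht]; exact Real.smoothTransition.le_one s)
  refine ⟨fun i s => if i = j then a * deriv Real.smoothTransition s else 0,
    fun s => X (Real.smoothTransition s), fun i => ?_, fun i t ht => by simp [hmin t ht],
    fun i t ht => by simp [hmax t ht],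
    fun t ht => by simp [Real.smoothTransition.zero_of_nonpos ht],
    fun t ht => by simp [Real.smoothTransition.one_of_one_le ht], fun t => ?_⟩
  · dsimp only
    split_ifs
    · exact contDiff_const.mul (contDiff_infty_iff_deriv.1 hθ).2
    · exact contDiff_const
  · have h := (hX _ ⟨Real.smoothTransition.nonneg t, Real.smoothTransition.le_one t⟩).scomp t
      ((hθ.differentiable (by simp)) t).hasDerivAt
    refine h.congr_deriv ?_
    simp [ite_smul, smul_smul, mul_comm]

/-- `y` is reached from `x`, and nearby starting points can be steered by a map continuous at `x`
sending `x` to `y`. -/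
def StablyReach (U : Fin d → E → E) (x y : E) : Prop :=
  ∃ Φ : E → E, ContinuousAt Φ x ∧ Φ x = y ∧ ∀ᶠ z in 𝓝 x, Reach U z (Φ z)

lemma StablyReach.refl (x : E) : StablyReach U x x :=
  ⟨id, continuousAt_id, rfl, Eventually.of_forall fun z => Reach.refl z⟩

lemma StablyReach.trans {x y z : E} (h : StablyReach U x y) (h' : StablyReach U y z) :
    StablyReach U x z := by
  obtain ⟨Φ, hΦ, rfl, hR⟩ := h
  obtain ⟨Ψ, hΨ, rfl, hR'⟩ := h'
  refine ⟨Ψ ∘ Φ, hΨ.comp hΦ, rfl, ?_⟩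
  filter_upwards [hR, hΦ.eventually hR'] with w h1 h2 using h1.trans h2

lemma StablyReach.reach {x y : E} (h : StablyReach U x y) : Reach U x y := by
  obtain ⟨Φ, -, rfl, hR⟩ := h
  exact hR.self_of_nhds

/-- If the points stably reachable from `x` contain a neighbourhood of one of them, then the points
reachable from `x` form a neighbourhood of `x`. -/
lemma StablyReach.eventually_reach {x y : E} (h : StablyReach U x y)
    (hy : ∀ᶠ z in 𝓝 y, Reach U x z) : ∀ᶠ z in 𝓝 x, Reach U x z := by
  obtain ⟨Φ, hΦ, rfl, hR⟩ := h
  filter_upwards [hR, hΦ.eventually hy] with w h1 h2 using h2.trans h1.symm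

lemma exists_contDiffAt_stablyReach [CompleteSpace E] (j : Fin d) (hU : ContDiff ℝ 2 (U j))
    (x₀ : E) :
    ∃ φ : ℝ × E → E, ContDiffAt ℝ 2 φ (0, x₀) ∧ φ (0, x₀) = x₀ ∧
      HasFDerivAt φ ((ContinuousLinearMap.fst ℝ ℝ E).smulRight (U j x₀) +
        ContinuousLinearMap.snd ℝ ℝ E) (0, x₀) ∧
      ∀ᶠ p in 𝓝 ((0 : ℝ), x₀), StablyReach U p.2 (φ p) := by
  obtain ⟨φ, hφ, hφ0, hφ', hev⟩ := exists_contDiffAt_flow (U j) hU x₀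
  refine ⟨φ, hφ, hφ0, hφ', ?_⟩
  have hR : ∀ᶠ p in 𝓝 ((0 : ℝ), x₀), Reach U p.2 (φ p) := by
    filter_upwards [hev] with p ⟨X, h0, h1, hX⟩
    rw [← h0, ← h1]
    exact Reach.of_integralCurve j p.1 X hX
  filter_upwards [hR.eventually_nhds, hφ.eventually (by simp)] with p hp hc
  have hι : Continuous fun z : E => (p.1, z) := by fun_prop
  exact ⟨fun z => φ (p.1, z), ContinuousAt.comp (x := p.2) (g := φ) hc.continuousAt hι.continuousAt,
    rfl, (hι.tendsto p.2).eventually hp⟩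

end Reach

section Tangency

variable {E P : Type*} [NormedAddCommGroup E] [NormedSpace ℝ E]
  [NormedAddCommGroup P] [NormedSpace ℝ P] [FiniteDimensional ℝ P]

lemma eventually_injective_fderiv {ψ : P → E} {p : P} (hψ : ContDiffAt ℝ 2 ψ p)
    (hinj : Function.Injective (fderiv ℝ ψ p)) :
    ∀ᶠ q in 𝓝 p, Function.Injective (fderiv ℝ ψ q) :=
  (hψ.fderiv_right (m := 1) (by norm_num)).continuousAt.eventually
    (ContinuousLinearMap.isOpen_injective.mem_nhds hinj)

variable [FiniteDimensional ℝ E]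

/-- Along a `C²` immersion, a tangent vector field has differentiable coordinates. -/
lemma exists_fderiv_tangent_field {ψ : P → E} {p : P} (hψ : ContDiffAt ℝ 2 ψ p)
    (hinj : Function.Injective (fderiv ℝ ψ p)) {V : E → E} (hV : DifferentiableAt ℝ V (ψ p))
    (htan : ∀ᶠ q in 𝓝 p, V (ψ q) ∈ range (fderiv ℝ ψ q)) :
    ∃ (a : P) (a' : P →L[ℝ] P), V (ψ p) = fderiv ℝ ψ p a ∧
      ∀ h, fderiv ℝ V (ψ p) (fderiv ℝ ψ p h) =
        fderiv ℝ (fderiv ℝ ψ) p h a + fderiv ℝ ψ p (a' h) := by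
  obtain ⟨L, hL⟩ := (fderiv ℝ ψ p).toLinearMap.exists_leftInverse_of_injective
    (LinearMap.ker_eq_bot.2 hinj)
  let L₀ : E →L[ℝ] P := LinearMap.toContinuousLinearMap L
  have hDψ : DifferentiableAt ℝ (fderiv ℝ ψ) p :=
    (hψ.fderiv_right (m := 1) (by norm_num)).differentiableAt (by simp)
  have hψd : DifferentiableAt ℝ ψ p := hψ.differentiableAt (by simp)
  let M : P → P →L[ℝ] P := fun q => L₀ ∘L fderiv ℝ ψ q
  have hM : DifferentiableAt ℝ M p := (differentiableAt_const L₀).clm_comp hDψ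
  have hMp : M p = 1 := by
    ext v
    exact LinearMap.congr_fun hL v
  have hunit : ∀ᶠ q in 𝓝 p, IsUnit (M q) :=
    hM.continuousAt.eventually (Units.isOpen.mem_nhds (by simp [hMp]))
  let a : P → P := fun q => Ring.inverse (M q) (L₀ (V (ψ q)))
  have hVψ : DifferentiableAt ℝ (fun q => V (ψ q)) p := DifferentiableAt.comp p hV hψd
  have ha : DifferentiableAt ℝ a p := by
    have h1 : DifferentiableAt ℝ (fun q => Ring.inverse (M q)) p :=
      DifferentiableAt.comp p (g := Ring.inverse) (differentiableAt_inverse (by simp [hMp])) hM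
    exact h1.clm_apply (L₀.differentiableAt.comp p hVψ)
  have heq : (fun q => V (ψ q)) =ᶠ[𝓝 p] fun q => fderiv ℝ ψ q (a q) := by
    filter_upwards [htan, hunit] with q ⟨c, hc⟩ hu
    have : a q = c := by
      have h2 : L₀ (V (ψ q)) = M q c := by rw [← hc]; rfl
      simp only [a, h2]
      rw [← mul_apply_eq_comp, Ring.inverse_mul_cancel _ hu]
      rfl
    rw [this, hc]
  refine ⟨a p, fderiv ℝ a p, heq.self_of_nhds, fun h => ?_⟩
  have hl : HasFDerivAt (fun q => V (ψ q)) (fderiv ℝ V (ψ p) ∘L fderiv ℝ ψ p) p :=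
    hV.hasFDerivAt.comp p hψd.hasFDerivAt
  have hr := hDψ.hasFDerivAt.clm_apply ha.hasFDerivAt
  have := DFunLike.congr_fun (hl.unique (hr.congr_of_eventuallyEq heq)) h
  simpa [add_comm] using this

/-- The Lie bracket of two vector fields tangent to a `C²` immersion is tangent to it. -/
lemma lieBracketVF_mem_range {ψ : P → E} {p : P} (hψ : ContDiffAt ℝ 2 ψ p)
    (hinj : Function.Injective (fderiv ℝ ψ p)) {V W : E → E} (hV : DifferentiableAt ℝ V (ψ p))
    (hW : DifferentiableAt ℝ W (ψ p))
    (hVt : ∀ᶠ q in 𝓝 p, V (ψ q) ∈ range (fderiv ℝ ψ q))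
    (hWt : ∀ᶠ q in 𝓝 p, W (ψ q) ∈ range (fderiv ℝ ψ q)) :
    lieBracketVF V W (ψ p) ∈ range (fderiv ℝ ψ p) := by
  obtain ⟨a, a', ha, hVa⟩ := exists_fderiv_tangent_field hψ hinj hV hVt
  obtain ⟨b, b', hb, hWb⟩ := exists_fderiv_tangent_field hψ hinj hW hWt
  refine ⟨b' a - a' b, ?_⟩
  have hsymm := hψ.isSymmSndFDerivAt (by simp) a b
  rw [lieBracketVF, ha, hb, hVa, hWb, hsymm, map_sub]
  abel

/-- If smooth vector fields are tangent to a `C²` immersion, then so is the Lie algebra they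
generate. -/
lemma eventually_mem_range_of_mem_lieGen {ψ : P → E} {p : P} (hψ : ContDiffAt ℝ 2 ψ p)
    (hinj : Function.Injective (fderiv ℝ ψ p)) {S : Set (E → E)}
    (hS : ∀ V ∈ S, ContDiff ℝ (⊤ : ℕ∞) V)
    (hSt : ∀ V ∈ S, ∀ᶠ q in 𝓝 p, V (ψ q) ∈ range (fderiv ℝ ψ q)) {W : E → E}
    (hW : W ∈ lieGen S) : ∀ᶠ q in 𝓝 p, W (ψ q) ∈ range (fderiv ℝ ψ q) := by
  refine (hW {V | ContDiff ℝ (⊤ : ℕ∞) V ∧ ∀ᶠ q in 𝓝 p, V (ψ q) ∈ range (fderiv ℝ ψ q)}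
    ⟨fun V hV => ⟨hS V hV, hSt V hV⟩, ⟨contDiff_const, Eventually.of_forall fun q => ⟨0, by simp⟩⟩,
      ?_, ?_, ?_⟩).2
  · rintro f g ⟨hf, hft⟩ ⟨hg, hgt⟩
    refine ⟨hf.add hg, ?_⟩
    filter_upwards [hft, hgt] with q ⟨a, ha⟩ ⟨b, hb⟩
    exact ⟨a + b, by simp [ha, hb]⟩
  · rintro c f ⟨hf, hft⟩
    refine ⟨hf.const_smul c, ?_⟩
    filter_upwards [hft] with q ⟨a, ha⟩
    exact ⟨c • a, by simp [ha]⟩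
  · rintro f g ⟨hf, hft⟩ ⟨hg, hgt⟩
    refine ⟨((hg.fderiv_right (m := (⊤ : ℕ∞)) (by simp)).clm_apply hf).sub
      ((hf.fderiv_right (m := (⊤ : ℕ∞)) (by simp)).clm_apply hg), ?_⟩
    filter_upwards [hψ.eventually (by simp), eventually_injective_fderiv hψ hinj,
      hft.eventually_nhds, hgt.eventually_nhds] with q hq hqi hfq hgq
    exact lieBracketVF_mem_range hq hqi (hf.differentiable (by simp) _)
      (hg.differentiable (by simp) _) hfq hgq

end Tangency

section Orbit

variable {E : Type*} [NormedAddCommGroup E] [NormedSpace ℝ E]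
  {d : ℕ} {U : Fin d → E → E} {Ω : Set E}

/-- Near `p`, the map `ψ` is a `C²` immersion into `Ω` with values stably reachable from `x`. -/
def IsReachableImmersionAt {P : Type*} [NormedAddCommGroup P] [NormedSpace ℝ P]
    (U : Fin d → E → E) (Ω : Set E) (x : E) (ψ : P → E) (p : P) : Prop :=
  ContDiffAt ℝ 2 ψ p ∧ Function.Injective (fderiv ℝ ψ p) ∧ ψ p ∈ Ω ∧
    ∀ᶠ q in 𝓝 p, StablyReach U x (ψ q)

lemma IsReachableImmersionAt.eventually {P : Type*} [NormedAddCommGroup P] [NormedSpace ℝ P]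
    [FiniteDimensional ℝ P] (hΩ : IsOpen Ω) {x : E} {ψ : P → E} {p : P}
    (h : IsReachableImmersionAt U Ω x ψ p) :
    ∀ᶠ q in 𝓝 p, IsReachableImmersionAt U Ω x ψ q := by
  obtain ⟨hψ, hinj, hmem, hR⟩ := h
  filter_upwards [hψ.eventually (by simp), eventually_injective_fderiv hψ hinj,
    hψ.continuousAt.eventually (hΩ.mem_nhds hmem), hR.eventually_nhds] with q h1 h2 h3 h4
  exact ⟨h1, h2, h3, h4⟩

variable [FiniteDimensional ℝ E]

/-- A vector field transverse to a reachable immersion produces a reachable immersion of one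
dimension more. -/
lemma IsReachableImmersionAt.exists_prod {P : Type*} [NormedAddCommGroup P] [NormedSpace ℝ P]
    {x : E} {ψ : P → E} {p : P} (h : IsReachableImmersionAt U Ω x ψ p) {j : Fin d}
    (hU : ContDiff ℝ 2 (U j)) (hj : U j (ψ p) ∉ range (fderiv ℝ ψ p)) :
    ∃ Ψ : ℝ × P → E, IsReachableImmersionAt U Ω x Ψ (0, p) := by
  have : CompleteSpace E := FiniteDimensional.complete ℝ E
  obtain ⟨hψ, hinj, hmem, hR⟩ := h
  obtain ⟨φ, hφ, hφ0, hφ', hφR⟩ := exists_contDiffAt_stablyReach j hU (ψ p)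
  let κ : ℝ × P → ℝ × E := fun z => (z.1, ψ z.2)
  have hκ : ContDiffAt ℝ 2 κ (0, p) :=
    contDiffAt_fst.prodMk (ContDiffAt.comp (0, p) (g := ψ) hψ contDiffAt_snd)
  have hκ' : HasFDerivAt κ ((ContinuousLinearMap.fst ℝ ℝ P).prod
      (fderiv ℝ ψ p ∘L ContinuousLinearMap.snd ℝ ℝ P)) (0, p) :=
    hasFDerivAt_fst.prodMk (HasFDerivAt.comp (0, p) (g := ψ)
      (hψ.differentiableAt (by simp)).hasFDerivAt hasFDerivAt_snd)
  refine ⟨φ ∘ κ, ContDiffAt.comp (0, p) (g := φ) hφ hκ, ?_, ?_, ?_⟩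
  · rw [(HasFDerivAt.comp (0, p) (g := φ) hφ' hκ').fderiv]
    refine (injective_iff_map_eq_zero _).2 fun z hz => ?_
    have hz' : z.1 • U j (ψ p) + fderiv ℝ ψ p z.2 = 0 := by simpa using hz
    have h1 : z.1 = 0 := by
      by_contra hne
      refine hj ⟨-(z.1⁻¹ • z.2), ?_⟩
      rw [map_neg, map_smul, eq_neg_of_add_eq_zero_right hz', smul_neg, neg_neg,
        inv_smul_smul₀ hne]
    refine Prod.ext h1 (hinj ?_)
    simpa [h1] using hz'
  · simpa [κ, hφ0] using hmem
  · have hs : Tendsto (Prod.snd : ℝ × P → P) (𝓝 (0, p)) (𝓝 p) := continuous_snd.tendsto' _ _ rfl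
    filter_upwards [hs.eventually hR, hκ.continuousAt.eventually hφR] with z h1 h2
      using h1.trans h2

lemma exists_reachableImmersion (hΩ : IsOpen Ω) (hU : ∀ i, ContDiff ℝ (⊤ : ℕ∞) (U i))
    (hLie : ∀ x ∈ Ω, ∀ w, ∃ W ∈ lieGen (range U), W x = w) {x : E} (hx : x ∈ Ω) (k : ℕ) :
    ∃ (P : Type) (_ : NormedAddCommGroup P) (_ : NormedSpace ℝ P) (_ : FiniteDimensional ℝ P)
      (ψ : P → E) (p : P), IsReachableImmersionAt U Ω x ψ p ∧
      (Function.Surjective (fderiv ℝ ψ p) ∨ Module.finrank ℝ P = k) := by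
  induction k with
  | zero =>
    refine ⟨PUnit, inferInstance, inferInstance, inferInstance, fun _ => x, 0,
      ⟨contDiffAt_const, Function.injective_of_subsingleton _, hx,
        Eventually.of_forall fun _ => StablyReach.refl x⟩, Or.inr ?_⟩
    exact Module.finrank_zero_of_subsingleton
  | succ k ih =>
    obtain ⟨P, _, _, _, ψ, p, h, hs | hk⟩ := ih
    · exact ⟨P, _, _, ‹_›, ψ, p, h, Or.inl hs⟩
    by_cases htan : ∀ i, ∀ᶠ q in 𝓝 p, U i (ψ q) ∈ range (fderiv ℝ ψ q)
    · refine ⟨P, _, _, ‹_›, ψ, p, h, Or.inl fun w => ?_⟩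
      obtain ⟨W, hW, rfl⟩ := hLie _ h.2.2.1 w
      refine (eventually_mem_range_of_mem_lieGen h.1 h.2.1 ?_ ?_ hW).self_of_nhds
      · rintro _ ⟨i, rfl⟩
        exact hU i
      · rintro _ ⟨i, rfl⟩
        exact htan i
    · push Not at htan
      obtain ⟨i, hi⟩ := htan
      obtain ⟨q, hq, hq'⟩ := (hi.and_eventually (h.eventually hΩ)).exists
      obtain ⟨Ψ, hΨ⟩ := hq'.exists_prod (contDiff_infty.1 (hU i) 2) hq
      exact ⟨ℝ × P, inferInstance, inferInstance, inferInstance, Ψ, (0, q), hΨ,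
        Or.inr (by rw [Module.finrank_prod, Module.finrank_self, hk, add_comm])⟩

lemma eventually_reach (hΩ : IsOpen Ω) (hU : ∀ i, ContDiff ℝ (⊤ : ℕ∞) (U i))
    (hLie : ∀ x ∈ Ω, ∀ w, ∃ W ∈ lieGen (range U), W x = w) {x : E} (hx : x ∈ Ω) :
    ∀ᶠ y in 𝓝 x, Reach U x y := by
  obtain ⟨P, _, _, _, ψ, p, ⟨hψ, hinj, -, hR⟩, hs⟩ :=
    exists_reachableImmersion hΩ hU hLie hx (Module.finrank ℝ E + 1)
  have hsurj : Function.Surjective (fderiv ℝ ψ p) := by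
    refine hs.resolve_right fun hk => ?_
    have := LinearMap.finrank_le_finrank_of_injective (f := (fderiv ℝ ψ p).toLinearMap) hinj
    omega
  have : CompleteSpace E := FiniteDimensional.complete ℝ E
  have : CompleteSpace P := FiniteDimensional.complete ℝ P
  have hmap := (hψ.hasStrictFDerivAt (by simp)).map_nhds_eq_of_surj (LinearMap.range_eq_top.2 hsurj)
  refine hR.self_of_nhds.eventually_reach ?_
  rw [← hmap, eventually_map]
  exact hR.mono fun q hq => hq.reach

end Orbit

/-- Chow–Rashevskii: if smooth bounded vector fields `U_1,…,U_d` on `ℝ^n`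
satisfy the Hörmander condition `Lie(U_1,…,U_d)(x) = ℝ^n` at every point of an open
connected set `Ω`, then for every `(x,y) ∈ Ω × Ω` there are smooth controls steering the
controlled ODE from `x` at time `0` to `y` at time `1`. -/
theorem chow_rashevskii
    (n d : ℕ)
    (Ω : Set (EuclideanSpace ℝ (Fin n)))
    (hΩopen : IsOpen Ω) (hΩconn : IsConnected Ω)
    (U : Fin d → EuclideanSpace ℝ (Fin n) → EuclideanSpace ℝ (Fin n))
    (hU : ∀ i, ContDiff ℝ (⊤ : ℕ∞) (U i))
    (hUbdd : ∀ i, ∃ C : ℝ, ∀ x, ‖U i x‖ ≤ C)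
    (hHormander : ∀ x ∈ Ω,
      {w : EuclideanSpace ℝ (Fin n) | ∃ W ∈ lieGen (Set.range U), W x = w} = Set.univ) :
    ∀ x ∈ Ω, ∀ y ∈ Ω,
      ∃ u : Fin d → ℝ → ℝ,
        (∀ i, ContDiff ℝ (⊤ : ℕ∞) (u i)) ∧
        ∃ X : ℝ → EuclideanSpace ℝ (Fin n),
          X 0 = x ∧
          (∀ t ∈ Set.Icc (0:ℝ) 1, HasDerivAt X (∑ i, u i t • U i (X t)) t) ∧
          X 1 = y := by
  intro x hx y hy
  have hLie : ∀ x ∈ Ω, ∀ w, ∃ W ∈ lieGen (range U), W x = w := fun x hx w =>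
    (hHormander x hx).ge (mem_univ w)
  have hR : Reach U x y := hΩconn.isPreconnected.induction₂ (Reach U)
    (fun z hz => nhdsWithin_le_nhds (eventually_reach hΩopen hU hLie hz))
    (fun _ _ _ _ _ _ h h' => h.trans h') (fun _ _ _ _ h => h.symm) hx hy
  obtain ⟨u, X, hu, -, -, hX0, hX1, hX⟩ := hR
  exact ⟨u, hu, X, hX0 0 le_rfl, fun t _ => hX t, hX1 1 le_rfl⟩
end
end

section
/- Let V_1,…,V_d : ℝ^m → ℝ^m be smooth vector fields and let x̄ = (x_1,…,x_N) be a tuple of pairwise distinct points of ℝ^m such that Lie(V_1,…,V_d) interpolates at x̄. Then the stacked vector fields V_1^{⊕N},…,V_d^{⊕N} satisfy the Hörmander condition at x̄, i.e. Lie(V_1^{⊕N},…,V_d^{⊕N})(x̄) = (ℝ^m)^N. -/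
open Set MeasureTheory

noncomputable section

/-- A collection `𝒱` of vector fields interpolates at the tuple `(x_1,…,x_N)` if for every
`(v_1,…,v_N)` there is `V̂ ∈ 𝒱` with `V̂(x_i) = v_i` for all `i`. -/
def Interpolates {F : Type*} {N : ℕ} (𝒱 : Set (F → F)) (x : Fin N → F) : Prop :=
  ∀ v : Fin N → F, ∃ Vh ∈ 𝒱, ∀ i, Vh (x i) = v i

/-- The stacked vector field `V^{⊕N}(x_1,…,x_N) = (V(x_1),…,V(x_N))` on `(ℝ^m)^N`. -/
def stackVF {m : ℕ} (N : ℕ)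
    (V : EuclideanSpace ℝ (Fin m) → EuclideanSpace ℝ (Fin m)) :
    (Fin N → EuclideanSpace ℝ (Fin m)) → (Fin N → EuclideanSpace ℝ (Fin m)) :=
  fun x i => V (x i)

open scoped ContDiff

theorem subset_lieGen {F : Type*} [NormedAddCommGroup F] [NormedSpace ℝ F] (S : Set (F → F)) :
    S ⊆ lieGen S :=
  fun _ hf _ hT => hT.1 hf

theorem zero_mem_lieGen {F : Type*} [NormedAddCommGroup F] [NormedSpace ℝ F] (S : Set (F → F)) :
    0 ∈ lieGen S :=
  fun _ hT => hT.2.1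

theorem add_mem_lieGen {F : Type*} [NormedAddCommGroup F] [NormedSpace ℝ F] {S : Set (F → F)}
    {f g : F → F} (hf : f ∈ lieGen S) (hg : g ∈ lieGen S) : f + g ∈ lieGen S :=
  fun T hT => hT.2.2.1 f g (hf T hT) (hg T hT)

theorem smul_mem_lieGen {F : Type*} [NormedAddCommGroup F] [NormedSpace ℝ F] {S : Set (F → F)}
    (c : ℝ) {f : F → F} (hf : f ∈ lieGen S) : c • f ∈ lieGen S :=
  fun T hT => hT.2.2.2.1 c f (hf T hT)

theorem lieBracketVF_mem_lieGen {F : Type*} [NormedAddCommGroup F] [NormedSpace ℝ F]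
    {S : Set (F → F)} {f g : F → F} (hf : f ∈ lieGen S) (hg : g ∈ lieGen S) :
    lieBracketVF f g ∈ lieGen S :=
  fun T hT => hT.2.2.2.2 f g (hf T hT) (hg T hT)

theorem contDiff_lieBracketVF {F : Type*} [NormedAddCommGroup F] [NormedSpace ℝ F]
    {U V : F → F} (hU : ContDiff ℝ ∞ U) (hV : ContDiff ℝ ∞ V) :
    ContDiff ℝ ∞ (lieBracketVF U V) :=
  ((hV.fderiv_right (m := ∞) le_rfl).clm_apply hU).sub
    ((hU.fderiv_right (m := ∞) le_rfl).clm_apply hV)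

theorem fderiv_stackVF_apply {m N : ℕ}
    {V : EuclideanSpace ℝ (Fin m) → EuclideanSpace ℝ (Fin m)} (hV : Differentiable ℝ V)
    (x v : Fin N → EuclideanSpace ℝ (Fin m)) (i : Fin N) :
    fderiv ℝ (stackVF N V) x v i = fderiv ℝ V (x i) (v i) := by
  have h : HasFDerivAt (stackVF N V) (ContinuousLinearMap.pi fun i =>
      (fderiv ℝ V (x i)).comp (ContinuousLinearMap.proj i)) x :=
    hasFDerivAt_pi.2 fun i => (hV (x i)).hasFDerivAt.comp x (hasFDerivAt_apply i x)
  rw [h.fderiv]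
  rfl

/-- Stacking commutes with the Lie bracket. -/
theorem stackVF_lieBracketVF {m : ℕ} (N : ℕ)
    {U V : EuclideanSpace ℝ (Fin m) → EuclideanSpace ℝ (Fin m)}
    (hU : Differentiable ℝ U) (hV : Differentiable ℝ V) :
    stackVF N (lieBracketVF U V) = lieBracketVF (stackVF N U) (stackVF N V) := by
  funext x i
  simp only [lieBracketVF, Pi.sub_apply, fderiv_stackVF_apply hU, fderiv_stackVF_apply hV]
  rfl

/-- Stacking maps the Lie algebra generated by smooth fields into the one generated by their
stacked versions. -/
theorem stackVF_mem_lieGen {m : ℕ} (N : ℕ)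
    {S : Set (EuclideanSpace ℝ (Fin m) → EuclideanSpace ℝ (Fin m))}
    (hS : ∀ f ∈ S, ContDiff ℝ ∞ f)
    {f : EuclideanSpace ℝ (Fin m) → EuclideanSpace ℝ (Fin m)} (hf : f ∈ lieGen S) :
    stackVF N f ∈ lieGen (stackVF N '' S) := by
  refine (hf {g | ContDiff ℝ ∞ g ∧ stackVF N g ∈ lieGen (stackVF N '' S)}
    ⟨fun g hg => ⟨hS g hg, subset_lieGen _ (mem_image_of_mem _ hg)⟩,
      ⟨contDiff_const, zero_mem_lieGen _⟩,
      fun g h hg hh => ⟨hg.1.add hh.1, add_mem_lieGen hg.2 hh.2⟩,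
      fun c g hg => ⟨hg.1.const_smul c, smul_mem_lieGen c hg.2⟩,
      fun g h hg hh => ⟨contDiff_lieBracketVF hg.1 hh.1, ?_⟩⟩).2
  rw [stackVF_lieBracketVF N (hg.1.differentiable (by simp)) (hh.1.differentiable (by simp))]
  exact lieBracketVF_mem_lieGen hg.2 hh.2

/-- if `Lie(V_1,…,V_d)` interpolates at a tuple `xbar` of pairwise distinct points,
then the stacked fields `V_1^{⊕N},…,V_d^{⊕N}` satisfy the Hörmander condition at `xbar`:
`Lie(V_1^{⊕N},…,V_d^{⊕N})(xbar) = (ℝ^m)^N`. -/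
theorem interpolates_implies_hormander
    (m d N : ℕ)
    (V : Fin d → EuclideanSpace ℝ (Fin m) → EuclideanSpace ℝ (Fin m))
    (hV : ∀ i, ContDiff ℝ (⊤ : ℕ∞) (V i))
    (xbar : Fin N → EuclideanSpace ℝ (Fin m))
    (hdist : Function.Injective xbar)
    (hinterp : Interpolates (lieGen (Set.range V)) xbar) :
    {w : Fin N → EuclideanSpace ℝ (Fin m) |
      ∃ W ∈ lieGen (Set.range fun i => stackVF N (V i)), W xbar = w} = Set.univ := by
  refine Set.eq_univ_of_forall fun w => ?_
  obtain ⟨Vh, hVh, hw⟩ := hinterp w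
  refine ⟨stackVF N Vh, ?_, funext hw⟩
  have h := stackVF_mem_lieGen N (Set.forall_mem_range.2 hV) hVh
  rwa [← Set.range_comp] at h
end
end
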